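/- arXiv:math/0510277 — 2 statements merged into one kernel-verified Lean document; each statement's English description precedes it below -/
import Mathlib

section
/- For every real number α with 1 < α ≤ 2, there exists a positive integer n_0 such that for all integers n ≥ n_0 there exists a prime p with n < p ≤ ⌊α·n⌋. -/
open MeasureTheory intervalIntegral Filter Topology

/-- The Fejér-type kernel, as a cosine integral. -/
noncomputable def fejK (l x : ℝ) : ℝ := ∫ t in (0:ℝ)..l, 2 * (1 - t / l) * Real.cos (t * x)

lemma fejK_cont (l : ℝ) : Continuous (fejK l) := by
  unfold fejK
  apply intervalIntegral.continuous_parametric_intervalIntegral_of_continuous'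
  fun_prop

lemma fejK_eq (l x : ℝ) (hl : 0 < l) (hx : x ≠ 0) :
    fejK l x = 2 * (1 - Real.cos (l * x)) / (l * x ^ 2) := by
  unfold fejK
  have h : ∀ t ∈ Set.uIcc 0 l, HasDerivAt
      (fun t => 2 * ((1 - t / l) * (Real.sin (t * x) / x) - Real.cos (t * x) / (l * x ^ 2)))
      (2 * (1 - t / l) * Real.cos (t * x)) t := by
    intro t _
    have h1 : HasDerivAt (fun t : ℝ => t * x) x t := by
      simpa using (hasDerivAt_id t).mul_const x
    have h2 : HasDerivAt (fun t : ℝ => 1 - t / l) (-(1 / l)) t := by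
      simpa using ((hasDerivAt_id t).div_const l).const_sub 1
    have := ((h2.mul (h1.sin.div_const x)).sub (h1.cos.div_const (l * x ^ 2))).const_mul 2
    refine this.congr_deriv ?_
    field_simp
    ring
  rw [intervalIntegral.integral_eq_sub_of_hasDerivAt h
    (Continuous.intervalIntegrable (by fun_prop) _ _)]
  simp
  field_simp
  ring

lemma fejK_zero (l : ℝ) (hl : 0 < l) : fejK l 0 = l := by
  have h : ∀ t ∈ Set.uIcc 0 l, HasDerivAt (fun t : ℝ => 2 * t - t ^ 2 / l)
      (2 * (1 - t / l) * Real.cos (t * 0)) t := by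
    intro t _
    have := ((hasDerivAt_id t).const_mul 2).sub (((hasDerivAt_id t).pow 2).div_const l)
    refine this.congr_deriv ?_
    simp
    ring
  unfold fejK
  rw [intervalIntegral.integral_eq_sub_of_hasDerivAt h
    (Continuous.intervalIntegrable (by fun_prop) _ _)]
  field_simp
  ring

lemma fejK_nonneg (l x : ℝ) (hl : 0 < l) : 0 ≤ fejK l x := by
  rcases eq_or_ne x 0 with rfl | hx
  · rw [fejK_zero l hl]; exact hl.le
  · rw [fejK_eq l x hl hx]
    have := Real.cos_le_one (l * x)
    apply div_nonneg <;> [linarith; positivity]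

lemma fejK_le (l x : ℝ) (hl : 0 < l) : fejK l x ≤ l := by
  rcases eq_or_ne x 0 with rfl | hx
  · rw [fejK_zero l hl]
  · rw [fejK_eq l x hl hx, div_le_iff₀ (by positivity)]
    have := Real.one_sub_sq_div_two_le_cos (x := l * x)
    nlinarith

lemma fejK_mul_sq_le (l x : ℝ) (hl : 0 < l) : fejK l x * x ^ 2 ≤ 4 / l := by
  rcases eq_or_ne x 0 with rfl | hx
  · simp; positivity
  · rw [fejK_eq l x hl hx, le_div_iff₀ hl]
    have := Real.neg_one_le_cos (l * x)
    field_simp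
    linarith

lemma fejK_ge (l x : ℝ) (hl : 0 < l) (hx : |x| ≤ 1 / l) : l / 2 ≤ fejK l x := by
  have e : l / 2 = ∫ t in (0:ℝ)..l, (1 / 2) * (2 * (1 - t / l) * Real.cos (t * 0)) := by
    rw [intervalIntegral.integral_const_mul]
    have := fejK_zero l hl
    unfold fejK at this
    rw [this]; ring
  rw [e]
  unfold fejK
  apply intervalIntegral.integral_mono_on hl.le
    (Continuous.intervalIntegrable (by fun_prop) _ _)
    (Continuous.intervalIntegrable (by fun_prop) _ _)
  intro t ht
  have h0 : 0 ≤ 1 - t / l := by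
    rw [sub_nonneg, div_le_one hl]; exact ht.2
  have h1 : |t * x| ≤ 1 := by
    rw [abs_mul, abs_of_nonneg ht.1]
    calc t * |x| ≤ l * (1 / l) := mul_le_mul ht.2 hx (abs_nonneg _) hl.le
      _ = 1 := by field_simp
  have h2 : (t * x) ^ 2 ≤ 1 := by
    rw [← sq_abs]; exact pow_le_one₀ (abs_nonneg _) h1
  have h3 := Real.one_sub_sq_div_two_le_cos (x := t * x)
  simp only [mul_zero, Real.cos_zero]
  nlinarith

lemma fejK_le_inv (l x : ℝ) (hl : 0 < l) : fejK l x ≤ (l + 4 / l) * (1 + x ^ 2)⁻¹ := by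
  rw [← div_eq_mul_inv, le_div_iff₀ (by positivity)]
  linarith [fejK_mul_sq_le l x hl, fejK_le l x hl]

lemma fejK_one_ge (x B : ℝ) (hB : x ^ 2 ≤ B) : 2 * (1 - Real.cos x) ≤ fejK 1 x * B := by
  have h0 := fejK_nonneg 1 x one_pos
  rcases eq_or_ne x 0 with rfl | hx
  · simp only [Real.cos_zero, sub_self, mul_zero]
    exact mul_nonneg h0 (by simpa using hB)
  · refine le_trans (le_of_eq ?_) (mul_le_mul_of_nonneg_left hB h0)
    rw [fejK_eq 1 x one_pos hx]
    field_simp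

lemma fejK_shift (y : ℝ) : (1 + y ^ 2)⁻¹ ≤ 5 * (fejK 1 y + fejK 1 (y + Real.pi)) := by
  have hp := Real.pi_lt_d2
  have hp0 := Real.pi_pos
  have h1 := fejK_one_ge y (20 * (1 + y ^ 2)) (by nlinarith)
  have h2 := fejK_one_ge (y + Real.pi) (20 * (1 + y ^ 2)) (by nlinarith [sq_nonneg (y - Real.pi)])
  rw [Real.cos_add_pi] at h2
  rw [inv_le_iff_one_le_mul₀ (by positivity)]
  linarith

open ArithmeticFunction in
lemma vM_term_re (s t u : ℝ) (n : ℕ) :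
    (Complex.exp ((t * u : ℝ) * Complex.I) *
      LSeries.term (fun n => (vonMangoldt n : ℂ)) (s + t * Complex.I) n).re =
    vonMangoldt n / (n : ℝ) ^ s * Real.cos (t * (Real.log n - u)) := by
  rcases Nat.eq_zero_or_pos n with rfl | hn
  · simp
  have hn' : (0:ℝ) < n := by exact_mod_cast hn
  have hnc : (n : ℂ) ≠ 0 := by exact_mod_cast hn.ne'
  rw [LSeries.term_of_ne_zero hn.ne']
  have h1 : ((n : ℂ)) ^ ((s : ℂ) + t * Complex.I) =
      (((n : ℝ) ^ s : ℝ) : ℂ) * Complex.exp ((t * Real.log n : ℝ) * Complex.I) := by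
    rw [Complex.cpow_add _ _ hnc]
    congr 1
    · rw [Complex.ofReal_cpow hn'.le]; simp
    · rw [Complex.cpow_def_of_ne_zero hnc, Complex.natCast_log.symm]
      push_cast
      ring_nf
  rw [h1]
  have h2 : Complex.exp ((t * u : ℝ) * Complex.I) * ((vonMangoldt n : ℂ) /
      ((((n : ℝ) ^ s : ℝ) : ℂ) * Complex.exp ((t * Real.log n : ℝ) * Complex.I))) =
      ((vonMangoldt n / (n : ℝ) ^ s : ℝ) : ℂ) *
        Complex.exp ((-(t * (Real.log n - u)) : ℝ) * Complex.I) := by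
    have h3 : Complex.exp ((-(t * (Real.log n - u)) : ℝ) * Complex.I) =
      Complex.exp ((t * u : ℝ) * Complex.I) / Complex.exp ((t * Real.log n : ℝ) * Complex.I) := by
      rw [← Complex.exp_sub]; congr 1; push_cast; ring
    rw [h3]
    push_cast
    field_simp
  rw [h2, Complex.re_ofReal_mul, Complex.exp_ofReal_mul_I_re, Real.cos_neg]

open ArithmeticFunction in
lemma vM_summable (s : ℝ) (hs : 1 < s) : Summable (fun n : ℕ => vonMangoldt n / (n : ℝ) ^ s) := by
  have h := LSeriesSummable_vonMangoldt (s := (s : ℂ)) (by simpa using hs)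
  have h2 := Complex.reCLM.summable h
  refine h2.congr fun n => ?_
  have := vM_term_re s 0 0 n
  simpa using this

open ArithmeticFunction in
lemma vM_hasSum (l u s : ℝ) (hl : 0 < l) (hs : 1 < s) :
    HasSum (fun n : ℕ => vonMangoldt n / (n : ℝ) ^ s * fejK l (Real.log n - u))
      (∫ t in (0:ℝ)..l, 2 * (1 - t / l) * (Complex.exp ((t * u : ℝ) * Complex.I) *
        LSeries (fun n => (vonMangoldt n : ℂ)) (s + t * Complex.I)).re) := by
  have key := intervalIntegral.hasSum_integral_of_dominated_convergence (a := 0) (b := l)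
    (μ := volume)
    (F := fun (n : ℕ) (t : ℝ) => vonMangoldt n / (n : ℝ) ^ s *
      (2 * (1 - t / l) * Real.cos (t * (Real.log n - u))))
    (f := fun t => 2 * (1 - t / l) * (Complex.exp ((t * u : ℝ) * Complex.I) *
        LSeries (fun n => (vonMangoldt n : ℂ)) (s + t * Complex.I)).re)
    (fun n _ => vonMangoldt n / (n : ℝ) ^ s * 2) ?_ ?_ ?_ ?_ ?_
  · refine key.congr_fun ?_
    intro n
    simp only [fejK, intervalIntegral.integral_const_mul]
  · intro n
    exact Continuous.aestronglyMeasurable (by fun_prop)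
  · intro n
    refine Eventually.of_forall fun t ht => ?_
    rw [Set.uIoc_of_le hl.le] at ht
    have h0 : 0 ≤ 1 - t / l := by rw [sub_nonneg, div_le_one hl]; exact ht.2
    have h1 : 1 - t / l ≤ 1 := by
      have := div_nonneg ht.1.le hl.le
      linarith
    have h2 : 0 ≤ vonMangoldt n / (n : ℝ) ^ s := div_nonneg vonMangoldt_nonneg (by positivity)
    rw [norm_mul, norm_mul, Real.norm_of_nonneg h2, Real.norm_of_nonneg (by linarith)]
    have h3 := Real.abs_cos_le_one (t * (Real.log n - u))
    rw [← Real.norm_eq_abs] at h3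
    apply mul_le_mul_of_nonneg_left _ h2
    nlinarith [norm_nonneg (Real.cos (t * (Real.log n - u)))]
  · exact Eventually.of_forall fun t _ => (vM_summable s hs).mul_right 2
  · exact Continuous.intervalIntegrable (by fun_prop) _ _
  · refine Eventually.of_forall fun t _ => ?_
    have h := (LSeriesSummable_vonMangoldt (s := (s + t * Complex.I : ℂ))
      (by simpa using hs)).hasSum
    have h2 := (Complex.hasSum_re (h.mul_left (Complex.exp ((t * u : ℝ) * Complex.I)))).mul_left
      (2 * (1 - t / l))
    refine h2.congr_fun ?_
    intro n
    rw [vM_term_re]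
    ring

lemma pole_swap (l u e : ℝ) (he : 0 < e) :
    (∫ t in (0:ℝ)..l, 2 * (1 - t / l) * (Complex.exp ((t * u : ℝ) * Complex.I) *
        (1 / (e + t * Complex.I))).re) =
    ∫ y in Set.Ioi (0:ℝ), Real.exp (-e * y) * fejK l (y - u) := by
  have hint : Integrable (Function.uncurry fun (t y : ℝ) => 2 * (1 - t / l) *
      (Real.exp (-e * y) * Real.cos (t * (y - u))))
      ((volume.restrict (Set.uIoc 0 l)).prod (volume.restrict (Set.Ioi (0:ℝ)))) := by
    have h1 : Integrable (fun t : ℝ => 2 * (1 - t / l)) (volume.restrict (Set.uIoc 0 l)) := by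
      have : IntervalIntegrable (fun t : ℝ => 2 * (1 - t / l)) volume 0 l :=
        Continuous.intervalIntegrable (by fun_prop) _ _
      exact intervalIntegrable_iff.1 this
    have h2 : Integrable (fun y : ℝ => Real.exp (-e * y)) (volume.restrict (Set.Ioi (0:ℝ))) :=
      exp_neg_integrableOn_Ioi 0 he
    have h3 := (h1.mul_prod h2).bdd_mul (c := 1)
      (f := fun z : ℝ × ℝ => Real.cos (z.1 * (z.2 - u)))
      (Continuous.aestronglyMeasurable (by fun_prop))
      (Eventually.of_forall fun z => by
        rw [Real.norm_eq_abs]; exact Real.abs_cos_le_one _)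
    refine h3.congr (Eventually.of_forall fun z => ?_)
    simp only [Function.uncurry]
    ring
  have hsw := intervalIntegral_integral_swap hint
  have hR : ∀ y : ℝ, (∫ t in (0:ℝ)..l, 2 * (1 - t / l) *
      (Real.exp (-e * y) * Real.cos (t * (y - u)))) = Real.exp (-e * y) * fejK l (y - u) := by
    intro y
    unfold fejK
    rw [← intervalIntegral.integral_const_mul]
    congr 1
    ext t
    ring
  simp_rw [hR] at hsw
  rw [← hsw]
  congr 1
  ext t
  rw [MeasureTheory.integral_const_mul]
  congr 1
  have ha : (-(e + t * Complex.I) : ℂ).re < 0 := by simpa using he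
  have hI := integral_exp_mul_complex_Ioi ha 0
  have hII := integrableOn_exp_mul_complex_Ioi ha 0
  have h4 : (Complex.exp ((t * u : ℝ) * Complex.I) * (1 / (e + t * Complex.I))) =
      ∫ y in Set.Ioi (0:ℝ), Complex.exp ((t * u : ℝ) * Complex.I) *
        Complex.exp (-(e + t * Complex.I) * y) := by
    rw [MeasureTheory.integral_const_mul, hI, neg_div_neg_eq]
    simp
  rw [h4]
  have h5 := integral_re (hII.const_mul (Complex.exp ((t * u : ℝ) * Complex.I)))
  refine h5.symm.trans ?_
  congr 1
  ext y
  rw [← Complex.exp_add]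
  have : ((t * u : ℝ) * Complex.I + -(e + t * Complex.I) * y : ℂ) =
    ((-e * y : ℝ) : ℂ) + ((-(t * (y - u)) : ℝ) : ℂ) * Complex.I := by push_cast; ring
  rw [this, Complex.exp_add, ← Complex.ofReal_exp]
  change (_ : ℂ).re = _
  rw [Complex.re_ofReal_mul, Complex.exp_ofReal_mul_I_re, Real.cos_neg]

/-- The regularised negative logarithmic derivative of zeta on `re s = 1 + |e|`. -/
@[irreducible] noncomputable def regF (e t : ℝ) : ℂ :=
  ArithmeticFunction.vonMangoldt.LFunctionResidueClassAux (1 : ZMod 1)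
    (((1 + |e| : ℝ) : ℂ) + t * Complex.I)

lemma regF_cont : Continuous (Function.uncurry regF) := by
  have h := ArithmeticFunction.vonMangoldt.continuousOn_LFunctionResidueClassAux (1 : ZMod 1)
  unfold Function.uncurry regF
  refine h.comp_continuous (by fun_prop) ?_
  intro x
  simp

lemma regF_eq (e t : ℝ) (he : 0 < e) :
    LSeries (fun n => (ArithmeticFunction.vonMangoldt n : ℂ)) (((1 + e : ℝ) : ℂ) + t * Complex.I) =
      regF e t + 1 / (e + t * Complex.I) := by
  have h := ArithmeticFunction.vonMangoldt.eqOn_LFunctionResidueClassAux (q := 1) (a := 1)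
    isUnit_one (x := ((1 + e : ℝ) : ℂ) + t * Complex.I) (by simpa using he)
  unfold regF
  rw [abs_of_pos he, h]
  have h1 : ∀ n, ArithmeticFunction.vonMangoldt.residueClass (1 : ZMod 1) n =
      ArithmeticFunction.vonMangoldt n := by
    intro n
    apply Set.indicator_of_mem
    exact Subsingleton.elim _ _
  simp only [h1]
  have h2 : (((1 + e : ℝ) : ℂ) + t * Complex.I) - 1 = e + t * Complex.I := by push_cast; ring
  rw [h2]
  simp

/-- The regular part of the smoothed sum. -/
noncomputable def regQ (l u e : ℝ) : ℝ :=
  ∫ t in (0:ℝ)..l, 2 * (1 - t / l) * (Complex.exp ((t * u : ℝ) * Complex.I) * regF e t).re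

lemma regQ_cont (l u : ℝ) : Continuous (regQ l u) := by
  unfold regQ
  apply intervalIntegral.continuous_parametric_intervalIntegral_of_continuous'
  have hc : Continuous fun p : ℝ × ℝ => regF p.1 p.2 := regF_cont
  change Continuous fun p : ℝ × ℝ => 2 * (1 - p.2 / l) *
    (Complex.exp ((p.2 * u : ℝ) * Complex.I) * regF p.1 p.2).re
  fun_prop

lemma regQ_tendsto (l : ℝ) (hl : 0 < l) : Tendsto (fun u => regQ l u 0) atTop (𝓝 0) := by
  have h := Real.tendsto_integral_exp_smul_cocompact
    (Set.indicator (Set.Ioc 0 l) fun t : ℝ => ((2 * (1 - t / l) : ℝ) : ℂ) * regF 0 t)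
  have hc : Continuous (regF 0) := regF_cont.comp (by fun_prop : Continuous fun t : ℝ => ((0:ℝ), t))
  have ht : Tendsto (fun u : ℝ => -(u / (2 * Real.pi))) atTop (cocompact ℝ) := by
    have : Tendsto (fun u : ℝ => -(u / (2 * Real.pi))) atTop atBot :=
      tendsto_neg_atTop_atBot.comp (tendsto_id.atTop_div_const Real.two_pi_pos)
    exact this.mono_right atBot_le_cocompact
  have h2 := (Complex.continuous_re.tendsto 0).comp (h.comp ht)
  rw [Complex.zero_re] at h2
  refine h2.congr fun u => ?_
  simp only [Function.comp]
  have e1 : (fun v : ℝ => Real.fourierChar (-(v * -(u / (2 * Real.pi)))) •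
      Set.indicator (Set.Ioc 0 l) (fun t : ℝ => ((2 * (1 - t / l) : ℝ) : ℂ) * regF 0 t) v) =
      Set.indicator (Set.Ioc 0 l) (fun t : ℝ => ((2 * (1 - t / l) : ℝ) : ℂ) *
        (Complex.exp ((t * u : ℝ) * Complex.I) * regF 0 t)) := by
    ext v
    by_cases hv : v ∈ Set.Ioc 0 l
    · rw [Set.indicator_of_mem hv, Set.indicator_of_mem hv, Circle.smul_def,
        Real.fourierChar_apply, smul_eq_mul]
      have : (2 * Real.pi * -(v * -(u / (2 * Real.pi)))) = v * u := by
        field_simp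
      rw [this]
      ring
    · rw [Set.indicator_of_notMem hv, Set.indicator_of_notMem hv, smul_zero]
  rw [e1, MeasureTheory.integral_indicator measurableSet_Ioc,
    ← intervalIntegral.integral_of_le hl.le]
  unfold regQ
  have hi : IntervalIntegrable (fun t : ℝ => ((2 * (1 - t / l) : ℝ) : ℂ) *
        (Complex.exp ((t * u : ℝ) * Complex.I) * regF 0 t)) volume 0 l :=
    Continuous.intervalIntegrable (by fun_prop) _ _
  have := Complex.reCLM.intervalIntegral_comp_comm hi
  simp only [Complex.reCLM_apply, Complex.re_ofReal_mul] at this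
  exact this.symm

open ArithmeticFunction in
lemma vM_hasSum' (l u e : ℝ) (hl : 0 < l) (he : 0 < e) :
    HasSum (fun n : ℕ => vonMangoldt n / (n : ℝ) ^ (1 + e) * fejK l (Real.log n - u))
      (regQ l u e + ∫ y in Set.Ioi (0:ℝ), Real.exp (-e * y) * fejK l (y - u)) := by
  have h := vM_hasSum l u (1 + e) hl (by linarith)
  rw [← pole_swap l u e he]
  unfold regQ
  have hc : Continuous (regF e) := regF_cont.comp (by fun_prop : Continuous fun t : ℝ => (e, t))
  have hne : ∀ t : ℝ, (e + t * Complex.I : ℂ) ≠ 0 := by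
    intro t h0
    have := congrArg Complex.re h0
    simp at this
    exact he.ne' this
  have hc2 : Continuous fun t : ℝ => (1 / (e + t * Complex.I) : ℂ) :=
    continuous_const.div (by fun_prop) hne
  rw [← intervalIntegral.integral_add (Continuous.intervalIntegrable (by fun_prop) _ _)
    (Continuous.intervalIntegrable (by fun_prop) _ _)]
  convert h using 1
  congr 1
  ext t
  rw [regF_eq e t he, mul_add, Complex.add_re]
  ring

lemma fejK_shift_integrable (l u : ℝ) (hl : 0 < l) : Integrable fun y => fejK l (y - u) := by
  have h := (integrable_inv_one_add_sq.const_mul (l + 4 / l)).comp_sub_right u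
  refine h.mono' ((fejK_cont l).comp (by fun_prop)).aestronglyMeasurable
    (Eventually.of_forall fun y => ?_)
  rw [Real.norm_of_nonneg (fejK_nonneg l _ hl)]
  exact fejK_le_inv l _ hl

lemma expK_integrable (l u e : ℝ) (hl : 0 < l) (he : 0 < e) :
    IntegrableOn (fun y => Real.exp (-e * y) * fejK l (y - u)) (Set.Ioi 0) := by
  refine Integrable.mono' (fejK_shift_integrable l u hl).integrableOn
    (Continuous.aestronglyMeasurable (by have := fejK_cont l; fun_prop)) ?_
  refine (ae_restrict_iff' measurableSet_Ioi).2 (Eventually.of_forall fun y hy => ?_)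
  have h0 := fejK_nonneg l (y - u) hl
  rw [Real.norm_of_nonneg (by positivity)]
  have : Real.exp (-e * y) ≤ 1 := Real.exp_le_one_iff.2 (by nlinarith [Set.mem_Ioi.1 hy])
  nlinarith

lemma expK_le (l u e : ℝ) (hl : 0 < l) (he : 0 < e) :
    (∫ y in Set.Ioi (0:ℝ), Real.exp (-e * y) * fejK l (y - u)) ≤ ∫ y, fejK l y := by
  calc _ ≤ ∫ y in Set.Ioi (0:ℝ), fejK l (y - u) := by
        refine setIntegral_mono_on (expK_integrable l u e hl he)
          (fejK_shift_integrable l u hl).integrableOn measurableSet_Ioi fun y hy => ?_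
        have h0 := fejK_nonneg l (y - u) hl
        have : Real.exp (-e * y) ≤ 1 := Real.exp_le_one_iff.2 (by nlinarith [Set.mem_Ioi.1 hy])
        nlinarith
    _ ≤ ∫ y, fejK l (y - u) := setIntegral_le_integral (fejK_shift_integrable l u hl)
        (Eventually.of_forall fun y => fejK_nonneg l _ hl)
    _ = _ := integral_sub_right_eq_self (fejK l) u

lemma expK_ge (l u e : ℝ) (hl : 1 ≤ l) (hu : 1 ≤ u) (he : 0 < e) :
    Real.exp (-e * (u + 1)) ≤ ∫ y in Set.Ioi (0:ℝ), Real.exp (-e * y) * fejK l (y - u) := by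
  have hl0 : 0 < l := by linarith
  have hl1 : 1 / l ≤ 1 := by rw [div_le_one hl0]; exact hl
  have hl2 : 0 < 1 / l := by positivity
  calc Real.exp (-e * (u + 1)) =
      ∫ y in Set.Ioc (u - 1 / l) (u + 1 / l), Real.exp (-e * (u + 1)) * (l / 2) := by
        rw [setIntegral_const, smul_eq_mul, Measure.real, Real.volume_Ioc,
          ENNReal.toReal_ofReal (by linarith)]
        field_simp
        ring
    _ ≤ ∫ y in Set.Ioc (u - 1 / l) (u + 1 / l), Real.exp (-e * y) * fejK l (y - u) := by
        refine setIntegral_mono_on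
          (integrableOn_const (by simp)) ?_ measurableSet_Ioc fun y hy => ?_
        · exact (expK_integrable l u e hl0 he).mono_set fun y hy => by
            simp only [Set.mem_Ioi]; linarith [hy.1]
        · have h1 := fejK_ge l (y - u) hl0 (abs_le.2 ⟨by linarith [hy.1], by linarith [hy.2]⟩)
          have h2 : Real.exp (-e * (u + 1)) ≤ Real.exp (-e * y) :=
            Real.exp_le_exp.2 (by nlinarith [hy.2])
          exact mul_le_mul h2 h1 (by positivity) (Real.exp_pos _).le
    _ ≤ _ := by
        refine setIntegral_mono_set (expK_integrable l u e hl0 he)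
          (Eventually.of_forall fun y => mul_nonneg (Real.exp_pos _).le (fejK_nonneg l _ hl0))
          (LE.le.eventuallyLE fun y hy => ?_)
        simp only [Set.mem_Ioi]; linarith [hy.1]

open ArithmeticFunction in
lemma vM_upper (l u : ℝ) (hl : 0 < l) (s : Finset ℕ) :
    ∑ n ∈ s, vonMangoldt n / (n : ℝ) * fejK l (Real.log n - u) ≤
      regQ l u 0 + ∫ y, fejK l y := by
  have h1 : Tendsto (fun e : ℝ => ∑ n ∈ s, vonMangoldt n / (n : ℝ) ^ (1 + e) *
      fejK l (Real.log n - u)) (𝓝[>] 0)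
      (𝓝 (∑ n ∈ s, vonMangoldt n / (n : ℝ) * fejK l (Real.log n - u))) := by
    refine tendsto_finsetSum _ fun n _ => ?_
    rcases Nat.eq_zero_or_pos n with rfl | hn
    · simp
    have hn' : (n : ℝ) ≠ 0 := by positivity
    have hc : ContinuousAt (fun e : ℝ => vonMangoldt n / (n : ℝ) ^ (1 + e) *
      fejK l (Real.log n - u)) 0 := by
      refine ContinuousAt.mul (ContinuousAt.div continuousAt_const ?_ (by simp [hn'])) continuousAt_const
      exact ContinuousAt.rpow continuousAt_const (by fun_prop) (Or.inl hn')
    have := hc.tendsto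
    simp only [add_zero, Real.rpow_one] at this
    exact this.mono_left nhdsWithin_le_nhds
  have h2 : Tendsto (fun e => regQ l u e + ∫ y, fejK l y) (𝓝[>] 0)
      (𝓝 (regQ l u 0 + ∫ y, fejK l y)) :=
    (((regQ_cont l u).tendsto 0).mono_left nhdsWithin_le_nhds).add_const _
  refine le_of_tendsto_of_tendsto h1 h2 ?_
  filter_upwards [self_mem_nhdsWithin] with e he
  have he : 0 < e := he
  have h := vM_hasSum' l u e hl he
  have h3 := sum_le_hasSum s (fun n _ => mul_nonneg
    (div_nonneg vonMangoldt_nonneg (by positivity)) (fejK_nonneg l _ hl)) h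
  linarith [expK_le l u e hl he]

open ArithmeticFunction in
lemma vM_nonneg (l u : ℝ) (hl : 0 < l) (n : ℕ) :
    0 ≤ vonMangoldt n / (n : ℝ) * fejK l (Real.log n - u) :=
  mul_nonneg (div_nonneg vonMangoldt_nonneg (by positivity)) (fejK_nonneg l _ hl)

open ArithmeticFunction in
lemma vM_summable_one (l u : ℝ) (hl : 0 < l) :
    Summable fun n : ℕ => vonMangoldt n / (n : ℝ) * fejK l (Real.log n - u) :=
  summable_of_sum_le (vM_nonneg l u hl) (vM_upper l u hl)

open ArithmeticFunction in
lemma vM_lower (l u : ℝ) (hl : 1 ≤ l) (hu : 1 ≤ u) :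
    1 + regQ l u 0 ≤ ∑' n : ℕ, vonMangoldt n / (n : ℝ) * fejK l (Real.log n - u) := by
  have hl0 : 0 < l := by linarith
  have h2 : Tendsto (fun e => Real.exp (-e * (u + 1)) + regQ l u e) (𝓝[>] 0)
      (𝓝 (1 + regQ l u 0)) := by
    have hc : Continuous fun e => Real.exp (-e * (u + 1)) + regQ l u e := by
      have := regQ_cont l u
      fun_prop
    have := hc.tendsto 0
    simp only [neg_zero, zero_mul, Real.exp_zero] at this
    exact this.mono_left nhdsWithin_le_nhds
  refine le_of_tendsto h2 ?_
  filter_upwards [self_mem_nhdsWithin] with e he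
  have he : 0 < e := he
  have h := vM_hasSum' l u e hl0 he
  have h3 := hasSum_le (fun n => ?_) h (vM_summable_one l u hl0).hasSum
  · linarith [expK_ge l u e hl hu he]
  · apply mul_le_mul_of_nonneg_right _ (fejK_nonneg l _ hl0)
    rcases Nat.eq_zero_or_pos n with rfl | hn
    · simp
    have hn1 : (1:ℝ) ≤ n := by exact_mod_cast hn
    apply div_le_div_of_nonneg_left vonMangoldt_nonneg (by linarith)
    nth_rewrite 1 [← Real.rpow_one (n : ℝ)]
    exact Real.rpow_le_rpow_of_exponent_le hn1 (by linarith)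

open ArithmeticFunction in
lemma vM_poisson : ∃ C U : ℝ, 0 < C ∧ ∀ u, U ≤ u →
    Summable (fun n : ℕ => vonMangoldt n / (n : ℝ) * (1 + (Real.log n - u) ^ 2)⁻¹) ∧
    ∑' n : ℕ, vonMangoldt n / (n : ℝ) * (1 + (Real.log n - u) ^ 2)⁻¹ ≤ C := by
  have hev := (regQ_tendsto 1 one_pos).eventually (gt_mem_nhds (zero_lt_one (α := ℝ)))
  obtain ⟨U, hU⟩ := eventually_atTop.1 hev
  have hI : 0 ≤ ∫ y, fejK 1 y := integral_nonneg fun y => fejK_nonneg 1 y one_pos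
  refine ⟨10 * (1 + ∫ y, fejK 1 y), U + Real.pi, by positivity, fun u hu => ?_⟩
  have s1 := vM_summable_one 1 u one_pos
  have s2 := vM_summable_one 1 (u - Real.pi) one_pos
  have t1 := s1.tsum_le_of_sum_le (vM_upper 1 u one_pos)
  have t2 := s2.tsum_le_of_sum_le (vM_upper 1 (u - Real.pi) one_pos)
  have s3 := (s1.add s2).mul_left 5
  have hle : ∀ n : ℕ, vonMangoldt n / (n : ℝ) * (1 + (Real.log n - u) ^ 2)⁻¹ ≤
      5 * (vonMangoldt n / (n : ℝ) * fejK 1 (Real.log n - u) +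
        vonMangoldt n / (n : ℝ) * fejK 1 (Real.log n - (u - Real.pi))) := by
    intro n
    have h := fejK_shift (Real.log n - u)
    rw [show Real.log n - u + Real.pi = Real.log n - (u - Real.pi) by ring] at h
    have h0 : 0 ≤ vonMangoldt n / (n : ℝ) := div_nonneg vonMangoldt_nonneg (by positivity)
    nlinarith [mul_le_mul_of_nonneg_left h h0]
  have s4 : Summable (fun n : ℕ => vonMangoldt n / (n : ℝ) * (1 + (Real.log n - u) ^ 2)⁻¹) :=
    s3.of_nonneg_of_le (fun n => mul_nonneg (div_nonneg vonMangoldt_nonneg (by positivity))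
      (by positivity)) hle
  refine ⟨s4, ?_⟩
  have h5 := s4.tsum_le_tsum hle s3
  rw [tsum_mul_left, s1.tsum_add s2] at h5
  have p0 := Real.pi_pos
  have q1 := hU u (by linarith)
  have q2 := hU (u - Real.pi) (by linarith)
  linarith

open ArithmeticFunction in
lemma nonprime_tail : ∃ g : ℕ → ℝ, (∀ n, 0 ≤ g n) ∧ Summable g ∧
    ∀ n : ℕ, ¬ n.Prime → vonMangoldt n / (n : ℝ) ≤ g n := by
  refine ⟨_, fun n => ?_, vonMangoldt.summable_residueClass_non_primes_div (1 : ZMod 1),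
    fun n hn => ?_⟩
  · have := vonMangoldt.residueClass_nonneg (1 : ZMod 1) n
    positivity
  · have h1 : vonMangoldt.residueClass (1 : ZMod 1) n = vonMangoldt n := by
      apply Set.indicator_of_mem
      exact Subsingleton.elim _ _
    rw [if_neg hn, h1]

/-- Generalized Bertrand Postulate: for every `α` with `1 < α ≤ 2` there is a positive
integer `n₀` such that every `n ≥ n₀` admits a prime `p` with `n < p ≤ ⌊α n⌋`. -/
theorem stmt_7 (α : ℝ) (hα1 : 1 < α) (hα2 : α ≤ 2) :
    ∃ n₀ : ℕ, 0 < n₀ ∧ ∀ n : ℕ, n₀ ≤ n →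
      ∃ p : ℕ, p.Prime ∧ n < p ∧ p ≤ ⌊α * (n : ℝ)⌋₊ := by
  obtain ⟨C, U, hC, hP⟩ := vM_poisson
  obtain ⟨g, hg0, hgs, hg⟩ := nonprime_tail
  set d := Real.log α / 2 with hd
  have hd0 : 0 < d := half_pos (Real.log_pos hα1)
  set A := 4 * (1 + 1 / d ^ 2) with hA
  have hA0 : 0 < A := by positivity
  set l := 1 + 8 * A * C with hl
  have hl1 : 1 ≤ l := by rw [hl]; nlinarith [mul_pos hA0 hC]
  have hl0 : 0 < l := by linarith
  have hAC : A / l * C ≤ 1 / 8 := by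
    rw [div_mul_eq_mul_div, div_le_iff₀ hl0]
    rw [hl]; linarith
  obtain ⟨V, hV⟩ := eventually_atTop.1 ((regQ_tendsto l hl0).eventually
    (lt_mem_nhds (show (-(1/2) : ℝ) < 0 by norm_num)))
  have hlog : Tendsto (fun n : ℕ => Real.log n + d) atTop atTop :=
    tendsto_atTop_add_const_right _ _ (Real.tendsto_log_atTop.comp tendsto_natCast_atTop_atTop)
  have htail := (tendsto_sum_nat_add g).eventually (gt_mem_nhds (show 0 < 1 / (8 * l) by positivity))
  obtain ⟨N, hN⟩ := eventually_atTop.1 (htail.and ((hlog.eventually_ge_atTop U).and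
    ((hlog.eventually_ge_atTop V).and (hlog.eventually_ge_atTop 1))))
  refine ⟨N + 1, Nat.succ_pos _, fun n hn => ?_⟩
  obtain ⟨hT, hU', hV', h1'⟩ := hN n (by omega)
  by_contra! hno
  have hn0 : (0:ℝ) < n := by
    have : 0 < n := by omega
    exact_mod_cast this
  set u := Real.log n + d with hu
  obtain ⟨sP, tP⟩ := hP u hU'
  have hlow := vM_lower l u hl1 h1'
  have hQ := hV u hV'
  let g' : ℕ → ℝ := Set.indicator {m | n ≤ m} g
  have sg' : Summable g' := hgs.indicator _
  have tg' : ∑' m, g' m = ∑' k, g (k + n) := by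
    rw [← sg'.sum_add_tsum_nat_add n]
    rw [Finset.sum_eq_zero, zero_add]
    · congr 1
      ext k
      exact Set.indicator_of_mem (by simp) g
    · intro i hi
      exact Set.indicator_of_notMem (by simpa using hi) g
  have hle : ∀ m : ℕ, ArithmeticFunction.vonMangoldt m / (m : ℝ) * fejK l (Real.log m - u) ≤
      A / l * (ArithmeticFunction.vonMangoldt m / (m : ℝ) * (1 + (Real.log m - u) ^ 2)⁻¹) +
        l * g' m := by
    intro m
    have hg'0 : 0 ≤ g' m := Set.indicator_nonneg (fun _ _ => hg0 _) m
    have hL0 : 0 ≤ ArithmeticFunction.vonMangoldt m / (m : ℝ) :=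
      div_nonneg ArithmeticFunction.vonMangoldt_nonneg (by positivity)
    rcases Nat.eq_zero_or_pos m with rfl | hm
    · simp only [ArithmeticFunction.map_zero, zero_div, zero_mul, mul_zero, zero_add]
      positivity
    have hm0 : (0:ℝ) < m := by exact_mod_cast hm
    by_cases hw : n < m ∧ m ≤ ⌊α * (n : ℝ)⌋₊
    · have hnp : ¬ m.Prime := fun hp => absurd hw.2 (not_le.2 (hno m hp hw.1))
      have e1 : g' m = g m := Set.indicator_of_mem (show n ≤ m from hw.1.le) g
      have e2 := hg m hnp
      have e3 := fejK_le l (Real.log m - u) hl0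
      have e4 := fejK_nonneg l (Real.log m - u) hl0
      have e5 : ArithmeticFunction.vonMangoldt m / (m : ℝ) * fejK l (Real.log m - u) ≤
          g m * l := mul_le_mul e2 e3 e4 (hg0 m)
      have e6 : 0 ≤ A / l * (ArithmeticFunction.vonMangoldt m / (m : ℝ) *
        (1 + (Real.log m - u) ^ 2)⁻¹) := by positivity
      rw [e1]
      linarith
    · have hy : d ^ 2 ≤ (Real.log m - u) ^ 2 := by
        rcases not_and_or.1 hw with h | h
        · have : Real.log m ≤ Real.log n :=
            Real.log_le_log hm0 (by exact_mod_cast not_lt.1 h)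
          rw [hu]
          nlinarith
        · have h2 : α * n < m := (Nat.floor_lt (by positivity)).1 (not_le.1 h)
          have h3 : Real.log (α * n) ≤ Real.log m := Real.log_le_log (by positivity) h2.le
          rw [Real.log_mul (by positivity) hn0.ne'] at h3
          have h4 : Real.log α = 2 * d := by rw [hd]; ring
          rw [hu]
          nlinarith
      set y := Real.log m - u with hydef
      have hK : fejK l y ≤ A / l * (1 + y ^ 2)⁻¹ := by
        have h5 := fejK_mul_sq_le l y hl0
        have h6 := fejK_nonneg l y hl0
        rw [← div_eq_mul_inv, le_div_iff₀ (by positivity)]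
        have h7 : 1 + y ^ 2 ≤ y ^ 2 * (1 + 1 / d ^ 2) := by
          have : 1 ≤ y ^ 2 * (1 / d ^ 2) := by
            rw [mul_one_div, le_div_iff₀ (by positivity)]; linarith
          linarith
        calc fejK l y * (1 + y ^ 2) ≤ fejK l y * (y ^ 2 * (1 + 1 / d ^ 2)) :=
              mul_le_mul_of_nonneg_left h7 h6
          _ = fejK l y * y ^ 2 * (1 + 1 / d ^ 2) := by ring
          _ ≤ 4 / l * (1 + 1 / d ^ 2) := mul_le_mul_of_nonneg_right h5 (by positivity)
          _ = A / l := by rw [hA]; ring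
      have := mul_le_mul_of_nonneg_left hK hL0
      have h8 : 0 ≤ l * g' m := by positivity
      linarith
  have s1 := sP.mul_left (A / l)
  have s2 := sg'.mul_left l
  have hfin := (vM_summable_one l u hl0).tsum_le_tsum hle (s1.add s2)
  rw [s1.tsum_add s2, tsum_mul_left, tsum_mul_left, tg'] at hfin
  have h9 : A / l * ∑' m : ℕ, ArithmeticFunction.vonMangoldt m / (m : ℝ) *
      (1 + (Real.log m - u) ^ 2)⁻¹ ≤ A / l * C :=
    mul_le_mul_of_nonneg_left tP (by positivity)
  have h10 : l * ∑' k, g (k + n) ≤ 1 / 8 := by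
    calc l * ∑' k, g (k + n) ≤ l * (1 / (8 * l)) := mul_le_mul_of_nonneg_left hT.le hl0.le
      _ = 1 / 8 := by field_simp
  linarith
end

section
/- For every real number α with 1 < α ≤ 2, the quantity (π(α·x) − π(x)) / (x / log x) tends to α − 1 as x → ∞. -/
open Filter

noncomputable section
namespace PNT
open Topology MeasureTheory

/-- normalised Chebyshev function in logarithmic scale. -/
def F (t : ℝ) : ℝ := Chebyshev.psi (Real.exp t) * Real.exp (-t)

/-- error term, truncated to positive arguments. -/
def G (t : ℝ) : ℝ := Set.indicator (Set.Ioi 0) (fun t => F t - 1) t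

/-- a bound for everything. -/
def C : ℝ := Real.log 4 + 5

lemma F_nonneg (t : ℝ) : 0 ≤ F t :=
  mul_nonneg (Chebyshev.psi_nonneg _) (Real.exp_pos _).le

lemma F_le (t : ℝ) : F t ≤ C := by
  have h := Chebyshev.psi_le_const_mul_self (Real.exp_pos t).le
  have h2 : F t ≤ ((Real.log 4 + 4) * Real.exp t) * Real.exp (-t) :=
    mul_le_mul_of_nonneg_right h (Real.exp_pos _).le
  rw [mul_assoc, ← Real.exp_add] at h2
  simp at h2
  unfold C; linarith

lemma C_pos : 0 < C := by
  have : 0 < Real.log 4 := Real.log_pos (by norm_num)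
  unfold C; linarith

lemma F_measurable : Measurable F :=
  (Chebyshev.psi_mono.measurable.comp Real.measurable_exp).mul
    (Real.measurable_exp.comp measurable_neg)

lemma G_measurable : Measurable G :=
  (F_measurable.sub_const 1).indicator measurableSet_Ioi

lemma G_abs_le (t : ℝ) : |G t| ≤ C := by
  have h1 := F_nonneg t
  have h2 := F_le t
  have : 0 < Real.log 4 := Real.log_pos (by norm_num)
  have h3 : 1 ≤ C := by unfold C; linarith
  unfold G
  by_cases ht : t ∈ Set.Ioi (0:ℝ)
  · rw [Set.indicator_of_mem ht, abs_le]; constructor <;> linarith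
  · rw [Set.indicator_of_notMem ht]; simp; linarith

open ArithmeticFunction in
lemma L_eq {s : ℂ} (hs : 1 < s.re) :
    LSeries (fun n => (Λ n : ℂ)) s =
      vonMangoldt.LFunctionResidueClassAux (1 : ZMod 1) s + 1 / (s - 1) := by
  have h := vonMangoldt.eqOn_LFunctionResidueClassAux (q := 1) (a := 1) isUnit_one hs
  have h2 : vonMangoldt.residueClass (1 : ZMod 1) = (fun n => Λ n) := by
    ext n
    unfold vonMangoldt.residueClass
    rw [Set.indicator_of_mem]
    exact Subsingleton.elim (α := ZMod 1) _ _
  rw [h, h2]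
  simp

open ArithmeticFunction in
lemma L_int {s : ℂ} (hs : 1 < s.re) :
    LSeries (fun n => (Λ n : ℂ)) s =
      s * ∫ t in Set.Ioi (0 : ℝ), (F t : ℂ) * Complex.exp (-(s - 1) * t) := by
  have hpsi : ∀ x : ℝ, ∑ k ∈ Finset.Icc 1 ⌊x⌋₊, Λ k = Chebyshev.psi x := by
    intro x
    rw [Chebyshev.psi]; rfl
  rw [LSeries_eq_mul_integral_of_nonneg (fun n => Λ n) zero_le_one hs ?_
    (fun n => vonMangoldt_nonneg)]
  · congr 1
    have := integral_comp_exp_Ioi (fun t : ℝ => (∑ k ∈ Finset.Icc 1 ⌊t⌋₊, (Λ k : ℂ)) *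
      (t : ℂ) ^ (-(s + 1))) 0
    rw [Real.exp_zero] at this
    rw [← this]
    refine setIntegral_congr_fun measurableSet_Ioi fun t ht => ?_
    have h2 : (∑ k ∈ Finset.Icc 1 ⌊Real.exp t⌋₊, (Λ k : ℂ)) = (Chebyshev.psi (Real.exp t) : ℂ) := by
      rw [← hpsi]; push_cast; rfl
    simp only [h2, F]
    rw [Complex.cpow_def_of_ne_zero (by exact_mod_cast (Real.exp_pos t).ne'),
      ← Complex.ofReal_log (Real.exp_pos t).le, Real.log_exp]
    push_cast
    rw [Complex.real_smul, mul_left_comm, mul_assoc]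
    push_cast
    rw [← Complex.exp_add, ← Complex.exp_add]
    congr 2; ring
  · refine Asymptotics.IsBigO.of_bound (Real.log 4 + 4) (Eventually.of_forall fun n => ?_)
    have h1 := hpsi n
    rw [Nat.floor_natCast] at h1
    rw [h1, Real.norm_of_nonneg (Chebyshev.psi_nonneg _), Real.rpow_one,
      Real.norm_of_nonneg (Nat.cast_nonneg _)]
    exact Chebyshev.psi_le_const_mul_self (Nat.cast_nonneg _)

lemma exp_norm (z : ℂ) (t : ℝ) : ‖Complex.exp (-z * t)‖ = Real.exp (-z.re * t) := by
  rw [Complex.norm_exp]; simp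

lemma integrable_bdd_exp {f : ℝ → ℝ} (hf : Measurable f) {B : ℝ} (hB : ∀ t, |f t| ≤ B) {z : ℂ}
    (hz : 0 < z.re) :
    IntegrableOn (fun t : ℝ => (f t : ℂ) * Complex.exp (-z * t)) (Set.Ioi 0) := by
  have h := (integrableOn_exp_mul_Ioi (neg_lt_zero.mpr hz) 0).const_mul B
  refine Integrable.mono' h ?_ (Eventually.of_forall fun t => ?_)
  · exact ((Complex.measurable_ofReal.comp hf).mul (by fun_prop)).aestronglyMeasurable
  · rw [norm_mul, exp_norm, Complex.norm_real, Real.norm_eq_abs]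
    exact mul_le_mul_of_nonneg_right (hB t) (Real.exp_pos _).le

/-- boundary function -/
def H (z : ℂ) : ℂ :=
  (ArithmeticFunction.vonMangoldt.LFunctionResidueClassAux (1 : ZMod 1) (1 + z) - 1) / (1 + z)

lemma H_cont : ContinuousOn H {z | 0 ≤ z.re} := by
  unfold H
  refine ContinuousOn.div (ContinuousOn.sub ?_ continuousOn_const) (by fun_prop) ?_
  · refine (ArithmeticFunction.vonMangoldt.continuousOn_LFunctionResidueClassAux (1 : ZMod 1)).comp
      (f := fun z : ℂ => 1 + z) (by fun_prop) ?_
    intro z hz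
    simp at hz ⊢; exact hz
  · intro z hz h
    have := congrArg Complex.re h
    simp at this hz
    linarith

lemma G_laplace {z : ℂ} (hz : 0 < z.re) :
    ∫ t : ℝ, (G t : ℂ) * Complex.exp (-z * t) = H z := by
  have e1 : ∀ t : ℝ, (G t : ℂ) * Complex.exp (-z * t) = Set.indicator (Set.Ioi 0)
      (fun t : ℝ => (F t : ℂ) * Complex.exp (-z * t) - Complex.exp (-z * t)) t := by
    intro t
    unfold G
    by_cases ht : t ∈ Set.Ioi (0:ℝ)
    · rw [Set.indicator_of_mem ht, Set.indicator_of_mem ht]; push_cast; ring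
    · rw [Set.indicator_of_notMem ht, Set.indicator_of_notMem ht]; simp
  simp_rw [e1]
  rw [integral_indicator measurableSet_Ioi, integral_sub
    (integrable_bdd_exp F_measurable (B := C)
      (fun t => by rw [abs_of_nonneg (F_nonneg t)]; exact F_le t) hz)]
  · have hs : 1 < (1 + z).re := by simp [hz]
    have h1 := L_int hs
    rw [L_eq hs] at h1
    simp only [add_sub_cancel_left] at h1
    rw [integral_exp_mul_complex_Ioi (by simpa using hz)]
    have hz0 : z ≠ 0 := by rintro rfl; simp at hz
    have hz1 : 1 + z ≠ 0 := by
      intro h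
      have := congrArg Complex.re h
      simp at this; linarith
    have h2 : (∫ t in Set.Ioi (0 : ℝ), (F t : ℂ) * Complex.exp (-z * t)) =
      (ArithmeticFunction.vonMangoldt.LFunctionResidueClassAux (1 : ZMod 1) (1 + z) + 1 / z)
        / (1 + z) := by
      rw [h1]; field_simp
    rw [h2]
    unfold H
    simp only [Complex.ofReal_zero, mul_zero, Complex.exp_zero]
    field_simp
    ring
  · have := integrable_bdd_exp (f := fun _ => 1) measurable_const (B := 1) (by simp) hz
    simpa [IntegrableOn] using this

end PNT
end

noncomputable section
namespace PNT
open Topology MeasureTheory FourierTransform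

lemma fourier_mod (φ : ℝ → ℂ) (T t : ℝ) :
    𝓕 (fun y : ℝ => φ y * Complex.exp (2 * Real.pi * Complex.I * (T * y))) t = 𝓕 φ (t - T) := by
  rw [Real.fourier_eq', Real.fourier_eq']
  refine integral_congr_ae (Eventually.of_forall fun y => ?_)
  simp only [smul_eq_mul]
  rw [mul_comm (φ y), ← mul_assoc, ← Complex.exp_add]
  congr 2
  simp
  ring

lemma fourier_G (ε y : ℝ) (hε : 0 < ε) :
    𝓕 (fun t : ℝ => (G t : ℂ) * Complex.exp (-ε * t)) y = H (ε + 2 * Real.pi * Complex.I * y) := by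
  rw [← G_laplace (by simpa using hε), Real.fourier_eq']
  refine integral_congr_ae (Eventually.of_forall fun t => ?_)
  simp only [smul_eq_mul]
  rw [mul_left_comm, ← Complex.exp_add]
  congr 2
  simp
  ring

lemma G_eps_integrable (ε : ℝ) (hε : 0 < ε) :
    Integrable (fun t : ℝ => (G t : ℂ) * Complex.exp (-ε * t)) := by
  have h := integrable_bdd_exp G_measurable G_abs_le (z := ε) (by simpa using hε)
  rw [← integrable_indicator_iff measurableSet_Ioi] at h
  refine h.congr (Eventually.of_forall fun t => ?_)
  by_cases ht : t ∈ Set.Ioi (0:ℝ)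
  · simp only [Set.indicator_of_mem ht]
  · simp [G, Set.indicator_of_notMem ht]

lemma parseval {φ : ℝ → ℂ} (hφ : Continuous φ) (hc : HasCompactSupport φ) (T ε : ℝ) (hε : 0 < ε) :
    ∫ t : ℝ, 𝓕 φ (t - T) * ((G t : ℂ) * Complex.exp (-ε * t)) =
    ∫ y : ℝ, φ y * Complex.exp (2 * Real.pi * Complex.I * (T * y)) *
      H (ε + 2 * Real.pi * Complex.I * y) := by
  have hf : Integrable (fun y : ℝ => φ y * Complex.exp (2 * Real.pi * Complex.I * (T * y))) :=
    Continuous.integrable_of_hasCompactSupport (by fun_prop) hc.mul_right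
  have := VectorFourier.integral_fourierIntegral_smul_eq_flip (L := innerₗ ℝ)
    Real.continuous_fourierChar (by fun_prop : Continuous fun p : ℝ × ℝ => innerₗ ℝ p.1 p.2)
    hf (G_eps_integrable ε hε)
  rw [flip_innerₗ] at this
  simp_rw [← fourier_mod, ← fourier_G _ _ hε]
  exact this

lemma parseval_zero {φ : ℝ → ℂ} (hφ : Continuous φ) (hc : HasCompactSupport φ)
    (hK : Integrable (𝓕 φ)) (T : ℝ) :
    ∫ t : ℝ, 𝓕 φ (t - T) * (G t : ℂ) =
    ∫ y : ℝ, φ y * Complex.exp (2 * Real.pi * Complex.I * (T * y)) *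
      H (2 * Real.pi * Complex.I * y) := by
  have hKT : Integrable (fun t => 𝓕 φ (t - T)) := hK.comp_sub_right T
  have h1 : Tendsto (fun ε : ℝ => ∫ t : ℝ, 𝓕 φ (t - T) * ((G t : ℂ) * Complex.exp (-ε * t)))
      (𝓝[>] 0) (𝓝 (∫ t : ℝ, 𝓕 φ (t - T) * (G t : ℂ))) := by
    refine tendsto_integral_filter_of_dominated_convergence (fun t => ‖𝓕 φ (t - T)‖ * C) ?_ ?_ ?_ ?_
    · filter_upwards with ε
      exact hKT.aestronglyMeasurable.mul
        ((Complex.measurable_ofReal.comp G_measurable).mul (by fun_prop)).aestronglyMeasurable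
    · filter_upwards [self_mem_nhdsWithin] with ε hε
      filter_upwards with t
      rw [norm_mul]
      refine mul_le_mul_of_nonneg_left ?_ (norm_nonneg _)
      by_cases ht : t ∈ Set.Ioi (0:ℝ)
      · rw [norm_mul, exp_norm, Complex.norm_real]
        refine (mul_le_of_le_one_right (norm_nonneg _) ?_).trans (G_abs_le t)
        rw [Real.exp_le_one_iff]
        simp at ht hε ⊢
        positivity
      · simp [G, Set.indicator_of_notMem ht, C_pos.le]
    · exact hKT.norm.mul_const C
    · filter_upwards with t
      have : Continuous (fun ε : ℝ => 𝓕 φ (t - T) * ((G t : ℂ) * Complex.exp (-ε * t))) := by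
        fun_prop
      have h := this.tendsto 0
      simp at h
      simpa using h.mono_left nhdsWithin_le_nhds
  have h2 : Tendsto (fun ε : ℝ => ∫ y : ℝ, φ y * Complex.exp (2 * Real.pi * Complex.I * (T * y)) *
      H (ε + 2 * Real.pi * Complex.I * y)) (𝓝[>] 0)
      (𝓝 (∫ y : ℝ, φ y * Complex.exp (2 * Real.pi * Complex.I * (T * y)) *
      H (2 * Real.pi * Complex.I * y))) := by
    have hcomp : IsCompact ((fun p : ℝ × ℝ => (p.1 + 2 * Real.pi * Complex.I * p.2 : ℂ)) ''
        (Set.Icc 0 1 ×ˢ tsupport φ)) :=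
      (isCompact_Icc.prod hc).image (by fun_prop)
    obtain ⟨M, hM⟩ := hcomp.exists_bound_of_continuousOn (f := H) (H_cont.mono (by
      rintro _ ⟨p, hp, rfl⟩
      simpa using hp.1.1))
    have hcy : ∀ ε : ℝ, 0 ≤ ε → Continuous fun y : ℝ => H (ε + 2 * Real.pi * Complex.I * y) := by
      intro ε hε
      refine H_cont.comp_continuous (by fun_prop) ?_
      intro y; simpa using hε
    refine tendsto_integral_filter_of_dominated_convergence (fun y => ‖φ y‖ * M) ?_ ?_ ?_ ?_
    · filter_upwards [self_mem_nhdsWithin] with ε hε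
      have := hcy ε (le_of_lt hε)
      exact (by fun_prop : Continuous _).aestronglyMeasurable
    · have : ∀ᶠ ε : ℝ in 𝓝[>] 0, ε < 1 := nhdsWithin_le_nhds (gt_mem_nhds one_pos)
      filter_upwards [self_mem_nhdsWithin, this] with ε hε hε1
      filter_upwards with y
      have e : ‖Complex.exp (2 * Real.pi * Complex.I * (T * y))‖ = 1 := by
        rw [Complex.norm_exp]; simp
      rw [norm_mul, norm_mul, e, mul_one]
      by_cases hy : y ∈ tsupport φ
      · refine mul_le_mul_of_nonneg_left (hM _ ⟨(ε, y), ⟨⟨le_of_lt hε, hε1.le⟩, hy⟩, rfl⟩)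
          (norm_nonneg _)
      · rw [image_eq_zero_of_notMem_tsupport hy]; simp
    · exact (hφ.integrable_of_hasCompactSupport hc).norm.mul_const M
    · filter_upwards with y
      refine Tendsto.const_mul _ ?_
      have hmem : (2 * Real.pi * Complex.I * y : ℂ) ∈ {z : ℂ | 0 ≤ z.re} := by simp
      refine (H_cont _ hmem).tendsto.comp ?_
      refine tendsto_nhdsWithin_iff.mpr ⟨?_, ?_⟩
      · have : Continuous fun ε : ℝ => (ε + 2 * Real.pi * Complex.I * y : ℂ) := by fun_prop
        have h := this.tendsto 0
        simp only [Complex.ofReal_zero, zero_add] at h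
        exact h.mono_left nhdsWithin_le_nhds
      · filter_upwards [self_mem_nhdsWithin] with ε hε
        simpa using le_of_lt hε
  refine tendsto_nhds_unique_of_eventuallyEq h1 h2 ?_
  filter_upwards [self_mem_nhdsWithin] with ε hε
  exact parseval hφ hc T ε hε

lemma key {φ : ℝ → ℂ} (hφ : Continuous φ) (hc : HasCompactSupport φ) (hK : Integrable (𝓕 φ)) :
    Tendsto (fun T : ℝ => ∫ t : ℝ, 𝓕 φ (t - T) * (G t : ℂ)) atTop (𝓝 0) := by
  have h := Real.zero_at_infty_fourier (fun y : ℝ => φ y * H (2 * Real.pi * Complex.I * y))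
  have h2 : Tendsto (fun T : ℝ => -T) atTop (cocompact ℝ) := by
    refine tendsto_neg_atTop_atBot.mono_right ?_
    exact atBot_le_cocompact
  refine (h.comp h2).congr fun T => ?_
  rw [parseval_zero hφ hc hK, Function.comp, Real.fourier_eq']
  refine integral_congr_ae (Eventually.of_forall fun y => ?_)
  simp only [smul_eq_mul]
  have e : Complex.exp (((-2 * Real.pi * inner ℝ y (-T) : ℝ) : ℂ) * Complex.I) =
      Complex.exp (2 * Real.pi * Complex.I * (T * y)) := by
    congr 1
    simp
    ring
  rw [e]
  ring

end PNT
end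

noncomputable section
namespace PNT
open Topology MeasureTheory FourierTransform

lemma fourier_real_of_even {u : ℝ → ℝ} (hu : ∀ x, u (-x) = u x) (t : ℝ) :
    (((𝓕 (fun x => (u x : ℂ)) t).re : ℝ) : ℂ) = 𝓕 (fun x => (u x : ℂ)) t := by
  rw [← Complex.conj_eq_iff_re, Real.fourier_eq', ← integral_conj,
    ← integral_neg_eq_self]
  refine integral_congr_ae (Eventually.of_forall fun y => ?_)
  simp only [smul_eq_mul, map_mul, Complex.conj_ofReal, hu, ← Complex.exp_conj, Complex.conj_I]
  congr 2
  simp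

lemma exists_kernel : ∃ (φ : ℝ → ℂ) (K : ℝ → ℝ), Continuous φ ∧ HasCompactSupport φ ∧
    (∀ t, 𝓕 φ t = (K t : ℂ)) ∧ (∀ t, 0 ≤ K t) ∧ Integrable K ∧ ∫ t, K t = 1 := by
  let b : ContDiffBump (0 : ℝ) := ⟨1, 2, one_pos, one_lt_two⟩
  let u : ℝ → ℂ := fun x => (b x : ℂ)
  have hus : HasCompactSupport u := b.hasCompactSupport.comp_left (g := fun x : ℝ => (x : ℂ)) (by simp)
  have hud : ContDiff ℝ (⊤ : ℕ∞) u := Complex.ofRealCLM.contDiff.comp b.contDiff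
  have huc : Continuous u := hud.continuous
  have hui : Integrable u := huc.integrable_of_hasCompactSupport hus
  let U : SchwartzMap ℝ ℂ := hus.toSchwartzMap hud
  let k : ℝ → ℝ := fun t => (𝓕 u t).re
  have hk : ∀ t, (k t : ℂ) = 𝓕 u t := fun t => fourier_real_of_even (fun x => b.neg x) t
  have hUt : ∀ t, 𝓕 U t = 𝓕 u t := by
    intro t; rw [SchwartzMap.fourier_coe]; rfl
  let φ0 := convolution u u (ContinuousLinearMap.mul ℂ ℂ) volume
  have hφ0 : Continuous φ0 := by
    exact hus.continuous_convolution_right _ hui.locallyIntegrable huc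
  have hφs : HasCompactSupport φ0 := hus.convolution _ hus
  have hF : ∀ t, 𝓕 φ0 t = ((k t ^ 2 : ℝ) : ℂ) := by
    intro t
    rw [Real.fourier_mul_convolution_eq hui hui, ← hk]; push_cast; ring
  have hkc : Continuous k := by
    have : Continuous fun t => (𝓕 U t).re := Complex.continuous_re.comp (𝓕 U).continuous
    simpa only [hUt] using this
  have hki : Integrable (fun t => k t ^ 2) := by
    have h2 := (𝓕 U).memLp 2 (volume : Measure ℝ)
    have h3 : MemLp k 2 volume := by
      have := h2.re
      refine this.ae_eq (Eventually.of_forall fun t => ?_)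
      simp [k, hUt]
    exact h3.integrable_sq
  have hpos : 0 < ∫ t, k t ^ 2 := by
    refine integral_pos_of_integrable_nonneg_nonzero (x := 0) (by fun_prop) hki
      (fun t => sq_nonneg (k t)) ?_
    have h0 : (k 0 : ℂ) = ((∫ x, b x : ℝ) : ℂ) := by
      rw [hk, Real.fourier_eq', ← integral_complex_ofReal]
      simp [u]
    have h1 : k 0 = ∫ x, b x := by exact_mod_cast h0
    rw [h1]
    have := b.integral_pos (μ := volume)
    positivity
  let I := ∫ t, k t ^ 2
  refine ⟨fun y => ((I⁻¹ : ℝ) : ℂ) • φ0 y, fun t => I⁻¹ * k t ^ 2, ?_, ?_, ?_, ?_, ?_, ?_⟩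
  · fun_prop
  · exact hφs.smul_left (f := fun _ => ((I⁻¹ : ℝ) : ℂ))
  · intro t
    rw [Real.fourier_eq']
    simp_rw [smul_comm _ ((I⁻¹ : ℝ) : ℂ)]
    rw [integral_smul, ← Real.fourier_eq', hF]
    push_cast; rfl
  · intro t; positivity
  · exact hki.const_mul _
  · rw [integral_const_mul]
    exact inv_mul_cancel₀ hpos.ne'

lemma exists_kernel_conc {δ η : ℝ} (hδ : 0 < δ) (hη : 0 < η) :
    ∃ (φ : ℝ → ℂ) (K : ℝ → ℝ), Continuous φ ∧ HasCompactSupport φ ∧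
    (∀ t, 𝓕 φ t = (K t : ℂ)) ∧ (∀ t, 0 ≤ K t) ∧ Integrable K ∧ ∫ t, K t = 1 ∧
    1 - η ≤ ∫ t in Set.Icc (-δ) δ, K t := by
  obtain ⟨φ, K, h1, h2, h3, h4, h5, h6⟩ := exists_kernel
  have hlim : Tendsto (fun l : ℝ => ∫ t in (-(l * δ))..(l * δ), K t) atTop (𝓝 (∫ t, K t)) := by
    refine intervalIntegral_tendsto_integral h5 ?_ ?_
    · exact tendsto_neg_atTop_atBot.comp (tendsto_id.atTop_mul_const hδ)
    · exact tendsto_id.atTop_mul_const hδ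
  rw [h6] at hlim
  obtain ⟨l, hl, hl0⟩ := ((hlim.eventually (lt_mem_nhds (sub_lt_self 1 hη))).and
    (eventually_gt_atTop 0)).exists
  refine ⟨fun y => φ (l⁻¹ * y), fun t => l * K (l * t), by fun_prop, ?_, ?_, ?_, ?_, ?_, ?_⟩
  · exact h2.comp_homeomorph (Homeomorph.mulLeft₀ l⁻¹ (inv_ne_zero hl0.ne'))
  · intro t
    have := Measure.integral_comp_mul_left (fun y : ℝ =>
      Complex.exp (((-2 * Real.pi * inner ℝ y (l * t) : ℝ) : ℂ) * Complex.I) • φ y) l⁻¹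
    rw [← Real.fourier_eq', h3, inv_inv, abs_of_pos hl0] at this
    rw [Real.fourier_eq']
    push_cast
    rw [Complex.real_smul] at this
    rw [← this]
    refine integral_congr_ae (Eventually.of_forall fun y => ?_)
    simp only
    congr 3
    have : (l : ℂ) ≠ 0 := by exact_mod_cast hl0.ne'
    simp
    field_simp
  · intro t; exact mul_nonneg hl0.le (h4 _)
  · exact (h5.comp_mul_left' hl0.ne').const_mul l
  · rw [integral_const_mul, Measure.integral_comp_mul_left, h6, abs_of_pos (inv_pos.mpr hl0)]
    simp [hl0.ne']
  · rw [integral_Icc_eq_integral_Ioc, ← intervalIntegral.integral_of_le (by linarith),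
      intervalIntegral.integral_const_mul, intervalIntegral.integral_comp_mul_left _ hl0.ne']
    rw [smul_eq_mul, ← mul_assoc, mul_inv_cancel₀ hl0.ne', one_mul, mul_neg]
    exact hl.le

end PNT
end

noncomputable section
namespace PNT
open Topology MeasureTheory FourierTransform

lemma lower {K g : ℝ → ℝ} (hK0 : ∀ t, 0 ≤ K t) (hKi : Integrable K) (hK1 : ∫ t, K t = 1)
    (hg : Measurable g) {M A B δ : ℝ} (hM : ∀ t, |g t| ≤ M) (hA : ∀ s ∈ Set.Icc (-δ) δ, A ≤ g s)
    (hB : ∀ s, B ≤ g s) :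
    (A - B) * (∫ t in Set.Icc (-δ) δ, K t) + B ≤ ∫ t, K t * g t := by
  have e : (A - B) * (∫ t in Set.Icc (-δ) δ, K t) + B =
      ∫ t, ((A - B) * (Set.Icc (-δ) δ).indicator K t + B * K t) := by
    rw [integral_add ((hKi.indicator measurableSet_Icc).const_mul _) (hKi.const_mul _),
      integral_const_mul, integral_const_mul, integral_indicator measurableSet_Icc, hK1, mul_one]
  rw [e]
  refine integral_mono (((hKi.indicator measurableSet_Icc).const_mul _).add (hKi.const_mul _)) ?_ ?_
  · exact hKi.mul_bdd (c := M) hg.aestronglyMeasurable (Eventually.of_forall hM)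
  · intro t
    simp only
    by_cases ht : t ∈ Set.Icc (-δ) δ
    · rw [Set.indicator_of_mem ht]
      nlinarith [mul_le_mul_of_nonneg_left (hA t ht) (hK0 t)]
    · rw [Set.indicator_of_notMem ht]
      nlinarith [mul_le_mul_of_nonneg_left (hB t) (hK0 t)]

lemma F_slow {s t : ℝ} (h : s ≤ t) : F s * Real.exp (-(t - s)) ≤ F t := by
  unfold F
  rw [mul_assoc, ← Real.exp_add]
  have : -s + -(t - s) = -t := by ring
  rw [this]
  exact mul_le_mul_of_nonneg_right (Chebyshev.psi_mono (Real.exp_le_exp.mpr h)) (Real.exp_pos _).le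

lemma neg_one_le_G (t : ℝ) : -1 ≤ G t := by
  unfold G
  by_cases ht : t ∈ Set.Ioi (0:ℝ)
  · rw [Set.indicator_of_mem ht]; linarith [F_nonneg t]
  · rw [Set.indicator_of_notMem ht]; norm_num

lemma G_eq {t : ℝ} (ht : 0 < t) : G t = F t - 1 := Set.indicator_of_mem (Set.mem_Ioi.mpr ht) _

lemma bounds {δ : ℝ} (hδ : 0 < δ) :
    ∀ᶠ T in atTop, F (T - δ) * Real.exp (-(2 * δ)) * (1 - δ) ≤ 1 + δ ∧
      1 - (C + 2) * δ ≤ F (T + δ) * Real.exp (2 * δ) := by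
  obtain ⟨φ, K, h1, h2, h3, h4, h5, h6, h7⟩ := exists_kernel_conc hδ hδ
  have hm1 : ∫ t in Set.Icc (-δ) δ, K t ≤ 1 := by
    rw [← h6]; exact setIntegral_le_integral h5 (Eventually.of_forall h4)
  have hFi : Integrable (𝓕 φ) := by
    refine h5.ofReal.congr (Eventually.of_forall fun t => ?_)
    simp [h3]
  have hk := key h1 h2 hFi
  have hk2 : Tendsto (fun T : ℝ => ∫ s, K s * G (s + T)) atTop (𝓝 0) := by
    have := (Complex.continuous_re.tendsto 0).comp hk
    simp only [Complex.zero_re] at this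
    refine this.congr fun T => ?_
    rw [← integral_sub_right_eq_self _ T]
    simp only [Function.comp, h3, sub_add_cancel]
    simp only [← Complex.ofReal_mul]
    rw [integral_complex_ofReal, Complex.ofReal_re]
  have hA := hk2.eventually (gt_mem_nhds hδ)
  have hB := hk2.eventually (lt_mem_nhds (neg_lt_zero.mpr hδ))
  have hC := C_pos
  filter_upwards [hA, hB, eventually_gt_atTop δ] with T hT1 hT2 hT
  have hGm : Measurable fun s => G (s + T) := G_measurable.comp (measurable_add_const T)
  constructor
  · have := lower h4 h5 h6 hGm (A := F (T - δ) * Real.exp (-(2 * δ)) - 1) (B := -1) (δ := δ)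
      (fun t => G_abs_le _) ?_ (fun s => neg_one_le_G _)
    · have h0 : 0 ≤ F (T - δ) * Real.exp (-(2 * δ)) := mul_nonneg (F_nonneg _) (Real.exp_pos _).le
      nlinarith [mul_le_mul_of_nonneg_left h7 h0]
    · intro s hs
      rw [G_eq (by linarith [hs.1])]
      have hs2 := F_slow (s := T - δ) (t := s + T) (by linarith [hs.1])
      have : F (T - δ) * Real.exp (-(2 * δ)) ≤ F (T - δ) * Real.exp (-(s + T - (T - δ))) :=
        mul_le_mul_of_nonneg_left (Real.exp_le_exp.mpr (by linarith [hs.2])) (F_nonneg _)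
      linarith
  · have := lower (g := fun s => - G (s + T)) h4 h5 h6 hGm.neg
      (A := 1 - F (T + δ) * Real.exp (2 * δ)) (B := -C) (δ := δ) (M := C)
      (fun t => by rw [abs_neg]; exact G_abs_le _) ?_
      (fun s => by have := (abs_le.mp (G_abs_le (s + T))).2; linarith)
    · simp only [mul_neg, integral_neg] at this
      have h0 : 0 ≤ F (T + δ) * Real.exp (2 * δ) := mul_nonneg (F_nonneg _) (Real.exp_pos _).le
      nlinarith [mul_le_mul_of_nonneg_left hm1 h0, mul_le_mul_of_nonneg_left h7 hC.le]
    · intro s hs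
      rw [G_eq (by linarith [hs.1])]
      have hs2 := F_slow (s := s + T) (t := T + δ) (by linarith [hs.2])
      have h3 : F (s + T) = F (s + T) * Real.exp (-(T + δ - (s + T))) * Real.exp (δ - s) := by
        rw [mul_assoc, ← Real.exp_add]
        have : -(T + δ - (s + T)) + (δ - s) = 0 := by ring
        rw [this]; simp
      have h4 : F (s + T) ≤ F (T + δ) * Real.exp (δ - s) := by
        rw [h3]; exact mul_le_mul_of_nonneg_right hs2 (Real.exp_pos _).le
      have : F (T + δ) * Real.exp (δ - s) ≤ F (T + δ) * Real.exp (2 * δ) :=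
        mul_le_mul_of_nonneg_left (Real.exp_le_exp.mpr (by linarith [hs.1])) (F_nonneg _)
      linarith

lemma F_tendsto : Tendsto F atTop (𝓝 1) := by
  rw [tendsto_order]
  constructor
  · intro a ha
    have hc : Continuous fun δ : ℝ => (1 - (C + 2) * δ) * Real.exp (-(2 * δ)) := by fun_prop
    have hl := (hc.tendsto 0).mono_left (nhdsWithin_le_nhds (s := Set.Ioi 0))
    simp only [mul_zero, sub_zero, neg_zero, Real.exp_zero, mul_one] at hl
    obtain ⟨δ, h1, hδ⟩ := ((hl.eventually (lt_mem_nhds ha)).and self_mem_nhdsWithin).exists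
    have hb := (tendsto_atTop_add_const_right atTop (-δ) tendsto_id).eventually (bounds hδ)
    filter_upwards [hb] with T hT
    have h2 := hT.2
    simp only [id, neg_add_cancel_right] at h2
    have h3 := mul_le_mul_of_nonneg_right h2 (Real.exp_pos (-(2 * δ))).le
    rw [mul_assoc, ← Real.exp_add, add_neg_cancel, Real.exp_zero, mul_one] at h3
    linarith
  · intro a ha
    have hc : ContinuousAt (fun δ : ℝ => (1 + δ) / (1 - δ) * Real.exp (2 * δ)) 0 := by
      refine ContinuousAt.mul (ContinuousAt.div (by fun_prop) (by fun_prop) (by norm_num))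
        (by fun_prop)
    have hl := hc.tendsto.mono_left (nhdsWithin_le_nhds (s := Set.Ioi 0))
    simp only [mul_zero, sub_zero, add_zero, Real.exp_zero, mul_one, div_one] at hl
    have hlt : ∀ᶠ δ : ℝ in 𝓝[>] 0, δ < 1 := nhdsWithin_le_nhds (gt_mem_nhds one_pos)
    obtain ⟨δ, ⟨h1, hδ1⟩, hδ⟩ :=
      (((hl.eventually (gt_mem_nhds ha)).and hlt).and self_mem_nhdsWithin).exists
    have hb := (tendsto_atTop_add_const_right atTop δ tendsto_id).eventually (bounds hδ)
    filter_upwards [hb] with T hT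
    have h2 := hT.1
    simp only [id, add_sub_cancel_right] at h2
    have h3 := (le_div_iff₀ (by linarith : 0 < 1 - δ)).mpr h2
    have h4 := mul_le_mul_of_nonneg_right h3 (Real.exp_pos (2 * δ)).le
    rw [mul_assoc, ← Real.exp_add, neg_add_cancel, Real.exp_zero, mul_one] at h4
    linarith

lemma psi_tendsto : Tendsto (fun x => Chebyshev.psi x / x) atTop (𝓝 1) := by
  refine (F_tendsto.comp Real.tendsto_log_atTop).congr' ?_
  filter_upwards [eventually_gt_atTop 0] with x hx
  simp only [Function.comp, F]
  rw [Real.exp_neg, Real.exp_log hx, div_eq_mul_inv]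

lemma theta_tendsto : Tendsto (fun x => Chebyshev.theta x / x) atTop (𝓝 1) := by
  have h1 : (fun x : ℝ => √x) =o[atTop] (fun x : ℝ => x) := by
    refine Asymptotics.isLittleO_of_tendsto' ?_ ?_
    · filter_upwards [eventually_gt_atTop 0] with x hx h
      linarith
    · refine Real.tendsto_sqrt_atTop.inv_tendsto_atTop.congr' ?_
      filter_upwards with x
      simp only [Pi.inv_apply]
      rw [Real.sqrt_div_self]
  have h2 := (Chebyshev.isBigO_psi_sub_theta_sqrt.trans_isLittleO h1).tendsto_div_nhds_zero
  have h3 := psi_tendsto.sub h2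
  simp only [sub_zero] at h3
  refine h3.congr fun x => ?_
  simp only [Pi.sub_apply]; ring

lemma pi_tendsto : Tendsto (fun x : ℝ => (Nat.primeCounting ⌊x⌋₊ : ℝ) / (x / Real.log x))
    atTop (𝓝 1) := by
  have h1 : (fun x : ℝ => x / Real.log x ^ 2) =o[atTop] (fun x : ℝ => x / Real.log x) := by
    refine Asymptotics.isLittleO_of_tendsto' ?_ ?_
    · filter_upwards [eventually_gt_atTop 1] with x hx h
      have := Real.log_pos hx
      have : 0 < x / Real.log x := by positivity
      linarith
    · refine Real.tendsto_log_atTop.inv_tendsto_atTop.congr' ?_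
      filter_upwards [eventually_gt_atTop 1] with x hx
      have := Real.log_pos hx
      simp only [Pi.inv_apply]
      field_simp
  have h2 := (Chebyshev.primeCounting_sub_theta_div_log_isBigO.trans_isLittleO
    h1).tendsto_div_nhds_zero
  have h3 := h2.add theta_tendsto
  simp only [zero_add] at h3
  refine h3.congr' ?_
  filter_upwards [eventually_gt_atTop 1] with x hx
  have := Real.log_pos hx
  field_simp
  ring

end PNT
end

/-- For `1 < α ≤ 2`, `(π(αx) - π(x)) / (x / log x) → α - 1` as `x → ∞`. -/
theorem stmt_8 (α : ℝ) (hα1 : 1 < α) (hα2 : α ≤ 2) :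
    Tendsto (fun x : ℝ =>
        ((Nat.primeCounting ⌊α * x⌋₊ : ℝ) - (Nat.primeCounting ⌊x⌋₊ : ℝ)) / (x / Real.log x))
      atTop (nhds (α - 1)) := by
  have hα0 : 0 < α := by linarith
  have hm : Tendsto (fun x : ℝ => α * x) atTop atTop := tendsto_id.const_mul_atTop hα0
  have h1 := PNT.pi_tendsto.comp hm
  have h2 : Tendsto (fun x : ℝ => Real.log x / Real.log (α * x)) atTop (nhds 1) := by
    have h := (tendsto_const_nhds (x := Real.log α)).div_atTop (Real.tendsto_log_atTop.comp hm)
    have h' := (tendsto_const_nhds (x := (1:ℝ))).sub h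
    rw [sub_zero] at h'
    refine h'.congr' ?_
    filter_upwards [eventually_gt_atTop 1] with x hx
    have hp : 0 < Real.log (α * x) := Real.log_pos (by nlinarith)
    simp only [Function.comp]
    rw [eq_div_iff hp.ne', sub_mul, div_mul_cancel₀ _ hp.ne',
      Real.log_mul hα0.ne' (by linarith)]
    ring
  have h3 := ((h1.mul h2).const_mul α).sub PNT.pi_tendsto
  simp only [mul_one] at h3
  refine h3.congr' ?_
  filter_upwards [eventually_gt_atTop 1] with x hx
  have hp : 0 < Real.log (α * x) := Real.log_pos (by nlinarith)
  have hq : 0 < Real.log x := Real.log_pos hx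
  simp only [Function.comp]
  field_simp
end
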